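/- arXiv:2207.08873 — 3 statements merged into one kernel-verified Lean document; each statement's English description precedes it below -/
import Mathlib

section
/- Let U_4 = {u ∈ ℝ^n : u_i ≥ 0 for all i, u has at most k nonzero entries, and u_y ≤ 1 + (1/k)·max{Σ_{i∈S} u_i : S ⊆ Y∖{y}, |S| = k} for every y ∈ Y}. Then U_4 is representative for L^(4): for every p in the simplex Δ there exists u ∈ U_4 such that Σ_{y∈Y} p_y L^(4)(u,y) ≤ Σ_{y∈Y} p_y L^(4)(u',y) for all u' ∈ ℝ^n. -/
open scoped NNReal

def simplex (n : ℕ) : Set (Fin n → ℝ) := {p | (∀ i, 0 ≤ p i) ∧ ∑ i, p i = 1}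

noncomputable def sigmaTop (n m : ℕ) (u : Fin n → ℝ) : ℝ :=
  if h : ((Finset.univ : Finset (Fin n)).powersetCard m).Nonempty then
    ((Finset.univ : Finset (Fin n)).powersetCard m).sup' h (fun S => ∑ i ∈ S, u i)
  else 0

noncomputable def Lk (n k : ℕ) (u : Fin n → ℝ) (y : Fin n) : ℝ :=
  if h : (Finset.Icc 1 n).Nonempty then
    (Finset.Icc 1 n).sup' h
      (fun m => sigmaTop n m u / (m : ℝ) + max 0 (1 - (k : ℝ) / (m : ℝ))) - u y
  else 0

def indic {n : ℕ} (S : Finset (Fin n)) : Fin n → ℝ := fun i => if i ∈ S then 1 else 0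

noncomputable def nthLarge {n : ℕ} (v : Fin n → ℝ) (j : ℕ) : ℝ :=
  if h : n - j < n then v (Tuple.sort v ⟨n - j, h⟩) else 0

noncomputable def L2 (n k : ℕ) (u : Fin n → ℝ) (y : Fin n) : ℝ :=
  max 0 (1 - u y + (1 / (k : ℝ)) * sigmaTop n k (u - Pi.single y 1))

noncomputable def L3 (n k : ℕ) (u : Fin n → ℝ) (y : Fin n) : ℝ :=
  (1 / (k : ℝ)) * ∑ i ∈ Finset.Icc 1 k, max 0 (1 - u y + nthLarge (u - Pi.single y 1) i)

noncomputable def sigmaExcl (n k : ℕ) (u : Fin n → ℝ) (y : Fin n) : ℝ :=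
  if h : ((Finset.univ.erase y).powersetCard k).Nonempty then
    ((Finset.univ.erase y).powersetCard k).sup' h (fun S => ∑ i ∈ S, u i)
  else 0

noncomputable def L4 (n k : ℕ) (u : Fin n → ℝ) (y : Fin n) : ℝ :=
  max 0 (1 - u y + (1 / (k : ℝ)) * sigmaExcl n k u y)

noncomputable def ell2 (k : ℕ) {n : ℕ} (H M : Finset (Fin n)) (y : Fin n) : ℝ :=
  if y ∈ H then 0
  else if y ∈ M then ((H.card : ℝ) + M.card - 1) / ((k : ℝ) - H.card)
  else ((H.card : ℝ) + M.card - 1) / ((k : ℝ) - H.card) + ((k : ℝ) + 1) / k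

noncomputable def ell4 (k : ℕ) {n : ℕ} (T : Finset (Fin n)) (y : Fin n) : ℝ :=
  if y ∈ T then 0 else ((k : ℝ) + 1) / ((k : ℝ) + 1 - T.card)


/-- A layer-cake inequality: bounds on the sums of `a` over the superlevel sets of `x` integrate
to a bound on the sum weighted by the truncation of `x` at height `c`. -/
theorem sum_mul_min_le_of_sum_superlevel_le {ι : Type*} [Fintype ι] (a x : ι → ℝ) (b c : ℝ)
    (hc : 0 ≤ c) (hx : ∀ i, 0 ≤ x i)
    (h : ∀ t, 0 ≤ t → ∑ i, a i * (if t < x i then 1 else 0) ≤ b) :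
    ∑ i, a i * min (x i) c ≤ b * c := by
  have hintegrable : ∀ i, IntervalIntegrable (fun t => if t < x i then (1 : ℝ) else 0)
      MeasureTheory.volume 0 c := by
    intro i
    apply Antitone.intervalIntegrable
    intro s t hst
    dsimp only
    split_ifs with h₁ h₂ <;> linarith
  have hval : ∀ i, ∫ t in (0 : ℝ)..c, (if t < x i then (1 : ℝ) else 0) = min (x i) c := by
    intro i
    have hm : 0 ≤ min (x i) c := le_min (hx i) hc
    have hind : (fun t => if t < x i then (1 : ℝ) else 0) = (Set.Iio (x i)).indicator 1 := by
      ext t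
      simp [Set.indicator_apply]
    rw [intervalIntegral.integral_of_le hc, hind,
      MeasureTheory.integral_indicator_one measurableSet_Iio,
      MeasureTheory.measureReal_restrict_apply measurableSet_Iio]
    have hae : (Set.Iio (x i) ∩ Set.Ioc 0 c : Set ℝ) =ᵐ[MeasureTheory.volume]
        Set.Ioc 0 (min (x i) c) := by
      have hI : Set.Ioc 0 (min (x i) c) = Set.Iic (x i) ∩ Set.Ioc 0 c := by
        ext t
        simp only [Set.mem_Ioc, le_min_iff, Set.mem_inter_iff, Set.mem_Iic]
        tauto
      rw [hI]
      exact MeasureTheory.Iio_ae_eq_Iic.inter (MeasureTheory.ae_eq_refl _)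
    rw [MeasureTheory.measureReal_congr hae, Real.volume_real_Ioc_of_le hm, sub_zero]
  calc ∑ i, a i * min (x i) c
      = ∫ t in (0 : ℝ)..c, ∑ i, a i * (if t < x i then (1 : ℝ) else 0) := by
        rw [intervalIntegral.integral_finsetSum fun i _ => (hintegrable i).const_mul (a i)]
        simp only [intervalIntegral.integral_const_mul, hval]
    _ ≤ ∫ _ in (0 : ℝ)..c, b := by
        apply intervalIntegral.integral_mono_on hc _ intervalIntegrable_const
          fun t ht => h t ht.1
        simpa only [Finset.sum_fn] using
          IntervalIntegrable.sum Finset.univ fun i _ => (hintegrable i).const_mul (a i)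
    _ = b * c := by
        rw [intervalIntegral.integral_const, smul_eq_mul, sub_zero, mul_comm]

theorem sum_le_sigmaExcl {n k : ℕ} (u : Fin n → ℝ) {y : Fin n} {S : Finset (Fin n)}
    (hy : y ∉ S) (hS : S.card = k) : ∑ i ∈ S, u i ≤ sigmaExcl n k u y := by
  have hmem : S ∈ (Finset.univ.erase y).powersetCard k := by
    rw [Finset.mem_powersetCard]
    exact ⟨fun i hi => Finset.mem_erase.2 ⟨fun h => hy (h ▸ hi), Finset.mem_univ i⟩, hS⟩
  rw [sigmaExcl, dif_pos ⟨S, hmem⟩]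
  exact Finset.le_sup' (fun S => ∑ i ∈ S, u i) hmem

/-- For a nonnegative vector with at most `k` nonzero entries, the `k` largest entries besides `y`
account for everything except `u y`. -/
theorem sigmaExcl_eq_of_support_subset {n k : ℕ} (hkn : k < n) {u : Fin n → ℝ} (hu : ∀ i, 0 ≤ u i)
    {T : Finset (Fin n)} (hT : T.card ≤ k) (hTu : ∀ i ∉ T, u i = 0) (y : Fin n) :
    sigmaExcl n k u y = ∑ i, u i - u y := by
  rw [← Finset.sum_erase_eq_sub (Finset.mem_univ y)]
  obtain ⟨S, hTS, hSy, hS⟩ := Finset.exists_subsuperset_card_eq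
    (Finset.erase_subset_erase y (Finset.subset_univ T))
    ((Finset.card_erase_le).trans hT)
    (by rw [Finset.card_erase_of_mem (Finset.mem_univ y), Finset.card_fin]; omega)
  apply le_antisymm
  · rw [sigmaExcl, dif_pos ⟨S, Finset.mem_powersetCard.2 ⟨hSy, hS⟩⟩]
    refine Finset.sup'_le _ _ fun R hR => ?_
    exact Finset.sum_le_sum_of_subset_of_nonneg (Finset.mem_powersetCard.1 hR).1
      fun i _ _ => hu i
  · refine le_trans (le_of_eq ?_)
      (sum_le_sigmaExcl u (fun h => Finset.notMem_erase y _ (hSy h)) hS)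
    refine (Finset.sum_subset hSy fun i hi hiS => hTu i fun hiT => hiS (hTS ?_)).symm
    exact Finset.mem_erase.2 ⟨Finset.ne_of_mem_erase hi, hiT⟩

/-- Every vector is dominated, in the loss, by a nonnegative vector supported on `k` coordinates
(the excess over the `(k+1)`-st largest entry). -/
theorem exists_sparse_le_L4 {n k : ℕ} (hk : 1 ≤ k) (hkn : k < n) (v : Fin n → ℝ) :
    ∃ (x : Fin n → ℝ) (T : Finset (Fin n)), (∀ i, 0 ≤ x i) ∧ T.card = k ∧ (∀ i ∉ T, x i = 0) ∧
      ∀ y, max 0 (1 - x y + (1 / (k : ℝ)) * (∑ i, x i - x y)) ≤ L4 n k v y := by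
  have hk₀ : (0 : ℝ) < k := by exact_mod_cast hk
  obtain ⟨T, hTmem, hTmax⟩ := Finset.exists_max_image
    ((Finset.univ : Finset (Fin n)).powersetCard k) (fun S => ∑ i ∈ S, v i)
    (Finset.powersetCard_nonempty.2 (by simpa using hkn.le))
  have hT : T.card = k := (Finset.mem_powersetCard.1 hTmem).2
  have hne : (Tᶜ).Nonempty := by
    rw [← Finset.card_pos, Finset.card_compl, Fintype.card_fin]
    omega
  obtain ⟨j, hj, hjmax⟩ := Finset.exists_max_image Tᶜ v hne
  rw [Finset.mem_compl] at hj
  have hswap : ∀ y ∈ T, (insert j (T.erase y)).card = k ∧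
      ∑ i ∈ insert j (T.erase y), v i = v j + (∑ i ∈ T, v i - v y) := by
    intro y hy
    have hj' : j ∉ T.erase y := fun h => hj (Finset.mem_of_mem_erase h)
    rw [Finset.card_insert_of_notMem hj', Finset.card_erase_of_mem hy,
      Finset.sum_insert hj', Finset.sum_erase_eq_sub hy]
    exact ⟨by omega, rfl⟩
  have hge : ∀ y ∈ T, v j ≤ v y := by
    intro y hy
    have := hTmax _ (Finset.mem_powersetCard.2 ⟨Finset.subset_univ _, (hswap y hy).1⟩)
    rw [(hswap y hy).2] at this
    linarith
  have hsum : ∑ i, (if i ∈ T then v i - v j else 0) = ∑ i ∈ T, v i - k * v j := by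
    rw [Finset.sum_ite_mem, Finset.univ_inter, Finset.sum_sub_distrib, Finset.sum_const, hT,
      nsmul_eq_mul]
  refine ⟨fun i => if i ∈ T then v i - v j else 0, T, fun i => ?_, hT, fun i hi => if_neg hi,
    fun y => max_le_max le_rfl ?_⟩
  · dsimp only
    split_ifs with hi
    · exact sub_nonneg.2 (hge i hi)
    · exact le_rfl
  · dsimp only
    rw [hsum]
    have hcancel : 1 / (k : ℝ) * (k * v j) = v j := by field_simp
    split_ifs with hy
    · have hle := sum_le_sigmaExcl v (y := y) (S := insert j (T.erase y))
        (by
          rw [Finset.mem_insert, not_or]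
          exact ⟨fun h => hj (h ▸ hy), Finset.notMem_erase y T⟩) (hswap y hy).1
      rw [(hswap y hy).2] at hle
      have := mul_le_mul_of_nonneg_left hle (one_div_nonneg.2 hk₀.le)
      linarith
    · have := mul_le_mul_of_nonneg_left (sum_le_sigmaExcl v hy hT) (one_div_nonneg.2 hk₀.le)
      have := hjmax y (Finset.mem_compl.2 hy)
      linarith

theorem stmt15 (n k : ℕ) (hk : 1 ≤ k) (hkn : k < n) :
    ∀ p ∈ simplex n, ∃ u : Fin n → ℝ,
      ((∀ i, 0 ≤ u i) ∧ (∃ T : Finset (Fin n), T.card ≤ k ∧ ∀ i ∉ T, u i = 0) ∧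
        ∀ y : Fin n, u y ≤ 1 + (1 / (k : ℝ)) * sigmaExcl n k u y) ∧
      ∀ v : Fin n → ℝ, ∑ y, p y * L4 n k u y ≤ ∑ y, p y * L4 n k v y := by
  intro p hp
  obtain ⟨hp₀, hp₁⟩ := hp
  have hk₀ : (0 : ℝ) < k := by exact_mod_cast hk
  have hpos : ∀ T : Finset (Fin n), T.card ≤ k → (0 : ℝ) < k + 1 - T.card := by
    intro T hT
    have : (T.card : ℝ) ≤ k := by exact_mod_cast hT
    linarith
  obtain ⟨T, hTmem, hTmin⟩ := Finset.exists_min_image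
    (Finset.univ.filter fun T : Finset (Fin n) => T.card ≤ k)
    (fun T => ((k : ℝ) + 1) / (k + 1 - T.card) * (1 - ∑ i ∈ T, p i)) ⟨∅, by simp⟩
  have hT : T.card ≤ k := (Finset.mem_filter.1 hTmem).2
  have hD := hpos T hT
  set M := ((k : ℝ) + 1) / (k + 1 - T.card) * (1 - ∑ i ∈ T, p i) with hM
  have hM₀ : 0 ≤ M := by
    have : ∑ i ∈ T, p i ≤ 1 := hp₁ ▸
      Finset.sum_le_sum_of_subset_of_nonneg (Finset.subset_univ T) fun i _ _ => hp₀ i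
    exact mul_nonneg (by positivity) (by linarith)
  set c : ℝ := k / (k + 1 - T.card) with hc
  have hc₀ : 0 ≤ c := by positivity
  let u : Fin n → ℝ := fun i => if i ∈ T then c else 0
  have hu₀ : ∀ i, 0 ≤ u i := by
    intro i
    dsimp only [u]
    split_ifs
    · exact hc₀
    · exact le_rfl
  have hu : ∀ i ∉ T, u i = 0 := fun i hi => if_neg hi
  have husum : ∑ i, u i = T.card * c := by simp [u]
  have hσ := sigmaExcl_eq_of_support_subset hkn hu₀ hT hu
  have hfix : c = 1 + 1 / (k : ℝ) * (T.card * c - c) := by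
    rw [hc]
    field_simp
    ring
  have hloss : ∀ y, L4 n k u y = if y ∈ T then 0 else ((k : ℝ) + 1) / (k + 1 - T.card) := by
    intro y
    rw [L4, hσ, husum]
    by_cases hy : y ∈ T
    · have hy' : u y = c := if_pos hy
      rw [if_pos hy, hy', max_eq_left]
      linarith
    · have hval : 1 - 0 + 1 / (k : ℝ) * (T.card * c - 0) = (k + 1) / (k + 1 - T.card) := by
        rw [hc]
        field_simp
        ring
      rw [if_neg hy, hu y hy, hval, max_eq_right (by positivity)]
  have hrisk : ∑ y, p y * L4 n k u y = M := by
    have hcompl : ∑ y ∈ Tᶜ, p y = 1 - ∑ y ∈ T, p y := by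
      rw [← hp₁, ← Finset.sum_add_sum_compl T p]
      ring
    rw [hM, ← hcompl, Finset.mul_sum, ← Finset.sum_add_sum_compl T,
      Finset.sum_eq_zero fun y hy => by rw [hloss, if_pos hy, mul_zero], zero_add]
    refine Finset.sum_congr rfl fun y hy => ?_
    rw [hloss, if_neg (Finset.mem_compl.1 hy), mul_comm]
  refine ⟨u, ⟨hu₀, ⟨T, hT, hu⟩, fun y => ?_⟩, fun v => ?_⟩
  · rw [hσ, husum]
    by_cases hy : y ∈ T
    · have hy' : u y = c := if_pos hy
      rw [hy']
      exact hfix.le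
    · rw [hu y hy]
      have : 0 ≤ 1 / (k : ℝ) * (T.card * c - 0) := by
        rw [sub_zero]
        exact mul_nonneg (one_div_nonneg.2 hk₀.le) (mul_nonneg (Nat.cast_nonneg _) hc₀)
      linarith
  · rw [hrisk]
    obtain ⟨x, R, hx₀, hR, hxR, hxv⟩ := exists_sparse_le_L4 hk hkn v
    set s := ∑ i, x i with hs
    have hs₀ : 0 ≤ s := Finset.sum_nonneg fun i _ => hx₀ i
    set d : ℝ := (k + s) / (k + 1) with hd
    have hd₀ : 0 ≤ d := by positivity
    have hdk : (k + 1) * d = k + s := by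
      rw [hd]
      field_simp
    have hlayer := sum_mul_min_le_of_sum_superlevel_le (fun i => (k + 1) * p i - M) x
      ((k + 1) * (1 - M)) d hd₀ hx₀ (by
        intro t ht
        simp only [mul_ite, mul_one, mul_zero]
        rw [← Finset.sum_filter]
        set Q := Finset.univ.filter fun i => t < x i with hQ
        have hQk : Q.card ≤ k := by
          rw [← hR]
          refine Finset.card_le_card fun i hi => ?_
          by_contra hiR
          have := (Finset.mem_filter.1 hi).2
          rw [hxR i hiR] at this
          linarith
        have hmin := hTmin Q (Finset.mem_filter.2 ⟨Finset.mem_univ _, hQk⟩)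
        have hDQ := hpos Q hQk
        rw [div_mul_eq_mul_div, le_div_iff₀ hDQ] at hmin
        rw [Finset.sum_sub_distrib, ← Finset.mul_sum, Finset.sum_const, nsmul_eq_mul]
        linarith)
    have hpoint : ∀ y, (k + 1) * (d - min (x y) d) ≤ k * L4 n k v y := by
      intro y
      refine le_trans ?_ (mul_le_mul_of_nonneg_left (hxv y) hk₀.le)
      rw [mul_max_of_nonneg _ _ hk₀.le, mul_zero]
      rcases le_total (x y) d with h | h
      · rw [min_eq_left h]
        refine le_max_of_le_right (le_of_eq ?_)
        rw [mul_sub, hdk]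
        field_simp
        ring
      · rw [min_eq_right h, sub_self, mul_zero]
        exact le_max_left _ _
    have hsummed : ∑ y, p y * ((k + 1) * (d - min (x y) d)) ≤ ∑ y, p y * (k * L4 n k v y) :=
      Finset.sum_le_sum fun y _ => mul_le_mul_of_nonneg_left (hpoint y) (hp₀ y)
    have hleft : ∑ y, p y * ((k + 1) * (d - min (x y) d)) =
        (k + 1) * d - ∑ y, ((k + 1) * p y - M) * min (x y) d - M * ∑ y, min (x y) d := by
      rw [← mul_one ((k + 1) * d), ← hp₁, Finset.mul_sum, Finset.mul_sum,
        ← Finset.sum_sub_distrib, ← Finset.sum_sub_distrib]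
      exact Finset.sum_congr rfl fun y _ => by ring
    have hright : ∑ y, p y * (k * L4 n k v y) = k * ∑ y, p y * L4 n k v y := by
      rw [Finset.mul_sum]
      exact Finset.sum_congr rfl fun y _ => by ring
    have htrunc : M * ∑ y, min (x y) d ≤ M * s :=
      mul_le_mul_of_nonneg_left (Finset.sum_le_sum fun y _ => min_le_left _ _) hM₀
    rw [hleft, hright] at hsummed
    have hMd : M * ((k + 1) * d) = M * (k + s) := by rw [hdk]
    refine le_of_mul_le_mul_left ?_ hk₀
    linarith
end

section
/- Let T ⊆ Y with |T| ≤ k − 1, let z ∈ Y ∖ T, and let p be in the simplex Δ. Then Σ_{y∈Y} p_y ℓ̂_4(T, y) ≥ Σ_{y∈Y} p_y ℓ̂_4(T∪{z}, y) if and only if p_z ≥ (1 − Σ_{i∈T} p_i)/(k + 1 − |T|). -/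
open scoped NNReal

/-- The conditional risk of `T` is the mass missed by `T`, times the constant loss off `T`. -/
theorem sum_mul_ell4 {n : ℕ} (k : ℕ) (T : Finset (Fin n)) {p : Fin n → ℝ} (hp : ∑ i, p i = 1) :
    ∑ y, p y * ell4 k T y =
      (1 - ∑ i ∈ T, p i) * (((k : ℝ) + 1) / ((k : ℝ) + 1 - T.card)) := by
  have hcompl : 1 - ∑ i ∈ T, p i = ∑ i ∈ Tᶜ, p i := by
    rw [← hp, ← Finset.sum_add_sum_compl T p, add_sub_cancel_left]
  rw [hcompl, Finset.sum_mul,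
    ← Finset.sum_add_sum_compl T, Finset.sum_eq_zero (s := T), zero_add]
  · refine Finset.sum_congr rfl fun y hy => ?_
    rw [ell4, if_neg (Finset.mem_compl.mp hy)]
  · intro y hy
    rw [ell4, if_pos hy, mul_zero]

theorem stmt17 (n k : ℕ) (hk : 1 ≤ k) (hkn : k < n)
    (T : Finset (Fin n)) (hT : T.card ≤ k - 1) (z : Fin n) (hz : z ∉ T)
    (p : Fin n → ℝ) (hp : p ∈ simplex n) :
    ((∑ y, p y * ell4 k (insert z T) y) ≤ (∑ y, p y * ell4 k T y)) ↔
      (1 - ∑ i ∈ T, p i) / ((k : ℝ) + 1 - T.card) ≤ p z := by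
  have hcard : (T.card : ℝ) + 1 ≤ k := by
    exact_mod_cast (by omega : T.card + 1 ≤ k)
  have hk0 : (0 : ℝ) < (k : ℝ) + 1 := by positivity
  rw [sum_mul_ell4 k _ hp.2, sum_mul_ell4 k _ hp.2, Finset.sum_insert hz,
    Finset.card_insert_of_notMem hz, Nat.cast_add, Nat.cast_one, ← mul_div_assoc,
    ← mul_div_assoc, div_le_div_iff₀ (by linarith) (by linarith), div_le_iff₀ (by linarith),
    mul_right_comm, mul_right_comm _ ((k : ℝ) + 1), mul_le_mul_iff_of_pos_right hk0]
  constructor <;> intro h <;> linarith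
end

section
/- The surrogate L^(4) is consistent with respect to the top-k loss on P^(4) = {p ∈ Δ : p_[k] > 1 − σ_k(p)}, where p_[k] is the k-th largest entry of p: there exists a link function ψ : ℝ^n → R_k such that for every p ∈ P^(4) there exists ε > 0 such that every u ∈ ℝ^n with ψ(u) ∉ γ_k(p) satisfies Σ_{y∈Y} p_y L^(4)(u,y) ≥ ε + inf_{u'∈ℝ^n} Σ_{y∈Y} p_y L^(4)(u',y). -/
open scoped NNReal

/-- The positions of the `k` largest entries of `u`, ties being broken by `Tuple.sort`. -/
noncomputable def topSet {n : ℕ} (k : ℕ) (u : Fin n → ℝ) : Finset (Fin n) :=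
  (Finset.univ.filter fun i : Fin n => n - k ≤ i.val).map (Tuple.sort u).toEmbedding

lemma card_topSet {n k : ℕ} (hkn : k ≤ n) (u : Fin n → ℝ) : (topSet k u).card = k := by
  have h := Finset.card_filter_add_card_filter_not (s := (Finset.univ : Finset (Fin n)))
    (fun i : Fin n => i.val < n - k)
  rw [Fin.card_filter_val_lt, Finset.card_univ, Fintype.card_fin] at h
  simp only [not_lt] at h
  rw [topSet, Finset.card_map]
  omega

lemma nthLarge_le_of_mem_topSet {n k : ℕ} (hk : 1 ≤ k) (hkn : k < n) {u : Fin n → ℝ}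
    {i : Fin n} (hi : i ∈ topSet k u) : nthLarge u k ≤ u i := by
  have h : n - k < n := by omega
  simp only [topSet, Finset.mem_map, Finset.mem_filter, Finset.mem_univ, true_and] at hi
  obtain ⟨a, ha, rfl⟩ := hi
  rw [nthLarge, dif_pos h]
  exact Tuple.monotone_sort u (show (⟨n - k, h⟩ : Fin n) ≤ a from ha)

lemma le_nthLarge_of_notMem_topSet {n k : ℕ} (hk : 1 ≤ k) (hkn : k < n) {u : Fin n → ℝ}
    {i : Fin n} (hi : i ∉ topSet k u) : u i ≤ nthLarge u k := by
  have h : n - k < n := by omega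
  obtain ⟨a, rfl⟩ := (Tuple.sort u).surjective i
  have ha : a.val < n - k := by
    by_contra hc
    exact hi (Finset.mem_map.2 ⟨a, by simpa using hc, rfl⟩)
  rw [nthLarge, dif_pos h]
  exact Tuple.monotone_sort u (show a ≤ (⟨n - k, h⟩ : Fin n) from ha.le)

lemma sum_le_sum_topSet {n k : ℕ} (hk : 1 ≤ k) (hkn : k < n) (u : Fin n → ℝ)
    {S : Finset (Fin n)} (hS : S.card = k) : ∑ i ∈ S, u i ≤ ∑ i ∈ topSet k u, u i := by
  set c := nthLarge u k
  have h1 : ∑ i ∈ S, (u i - c) ≤ ∑ i, max (u i - c) 0 :=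
    (Finset.sum_le_sum fun i _ => le_max_left _ _).trans
      (Finset.sum_le_sum_of_subset_of_nonneg (Finset.subset_univ S) fun _ _ _ => le_max_right _ _)
  have h2 : ∑ i ∈ topSet k u, (u i - c) = ∑ i, max (u i - c) 0 := by
    rw [← Finset.sum_subset (Finset.subset_univ (topSet k u))]
    · refine Finset.sum_congr rfl fun i hi => (max_eq_left ?_).symm
      exact sub_nonneg.2 (nthLarge_le_of_mem_topSet hk hkn hi)
    · intro i _ hi
      exact max_eq_right (sub_nonpos.2 (le_nthLarge_of_notMem_topSet hk hkn hi))
  rw [← h2, Finset.sum_sub_distrib, Finset.sum_sub_distrib, Finset.sum_const, Finset.sum_const,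
    hS, card_topSet hkn.le] at h1
  linarith

lemma sum_topSet {n k : ℕ} (hk : 1 ≤ k) (hkn : k < n) (u : Fin n → ℝ) :
    ∑ i ∈ topSet k u, u i = sigmaTop n k u := by
  have hmem : topSet k u ∈ (Finset.univ : Finset (Fin n)).powersetCard k :=
    Finset.mem_powersetCard.2 ⟨Finset.subset_univ _, card_topSet hkn.le u⟩
  rw [sigmaTop, dif_pos ⟨_, hmem⟩]
  refine le_antisymm (Finset.le_sup' (fun S => ∑ i ∈ S, u i) hmem) (Finset.sup'_le _ _ ?_)
  intro S hS
  exact sum_le_sum_topSet hk hkn u (Finset.mem_powersetCard.1 hS).2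

lemma L4_nonneg (n k : ℕ) (u : Fin n → ℝ) (y : Fin n) : 0 ≤ L4 n k u y := le_max_left _ _

lemma le_L4_of_card {n k : ℕ} (u : Fin n → ℝ) {y : Fin n} {S : Finset (Fin n)}
    (hS : S.card = k) (hy : y ∉ S) : 1 - u y + (1 / (k : ℝ)) * ∑ i ∈ S, u i ≤ L4 n k u y := by
  have hmem : S ∈ (Finset.univ.erase y).powersetCard k :=
    Finset.mem_powersetCard.2 ⟨Finset.subset_erase.2 ⟨Finset.subset_univ _, hy⟩, hS⟩
  refine le_trans ?_ (le_max_right _ _)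
  rw [sigmaExcl, dif_pos ⟨_, hmem⟩]
  gcongr
  exact Finset.le_sup' (fun S => ∑ i ∈ S, u i) hmem

lemma sigmaExcl_le {n k : ℕ} {u : Fin n → ℝ} {y : Fin n} {c : ℝ} (hc : 0 ≤ c)
    (h : ∀ S : Finset (Fin n), S.card = k → y ∉ S → ∑ i ∈ S, u i ≤ c) :
    sigmaExcl n k u y ≤ c := by
  rw [sigmaExcl]
  split_ifs
  · refine Finset.sup'_le _ _ fun S hS => ?_
    obtain ⟨hsub, hcard⟩ := Finset.mem_powersetCard.1 hS
    exact h S hcard fun hy => Finset.notMem_erase y _ (hsub hy)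
  · exact hc

lemma one_le_L4_of_notMem_topSet {n k : ℕ} (hk : 1 ≤ k) (hkn : k < n) {u : Fin n → ℝ}
    {y : Fin n} (hy : y ∉ topSet k u) : 1 ≤ L4 n k u y := by
  have hk0 : (0 : ℝ) < k := by exact_mod_cast hk
  have h1 : (k : ℝ) * u y ≤ ∑ i ∈ topSet k u, u i := by
    have := Finset.card_nsmul_le_sum (topSet k u) u (u y) fun i hi =>
      (le_nthLarge_of_notMem_topSet hk hkn hy).trans (nthLarge_le_of_mem_topSet hk hkn hi)
    rwa [card_topSet hkn.le, nsmul_eq_mul] at this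
  have h2 := le_L4_of_card u (card_topSet hkn.le u) hy
  have h3 : u y ≤ (1 / (k : ℝ)) * ∑ i ∈ topSet k u, u i := by
    rw [one_div, inv_mul_eq_div, le_div_iff₀ hk0]
    linarith
  linarith

/-- Every label outside a `k`-set `T` competes with `T` as a whole. -/
lemma add_one_le_sum_L4_add_L4 {n k : ℕ} (hk : 1 ≤ k) (u : Fin n → ℝ) {T : Finset (Fin n)}
    (hT : T.card = k) {j : Fin n} (hj : j ∉ T) :
    (k : ℝ) + 1 ≤ ∑ i ∈ T, L4 n k u i + L4 n k u j := by
  have hk0 : (k : ℝ) ≠ 0 := by positivity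
  have h1 := le_L4_of_card u hT hj
  have h2 : ∀ i ∈ T, 1 - u i + (1 / (k : ℝ)) * (u j + (∑ i ∈ T, u i - u i)) ≤ L4 n k u i := by
    intro i hi
    have hj' : j ∉ T.erase i := fun h => hj (Finset.mem_of_mem_erase h)
    have hcard : (insert j (T.erase i)).card = k := by
      rw [Finset.card_insert_of_notMem hj', Finset.card_erase_of_mem hi, hT]
      omega
    have hi' : i ∉ insert j (T.erase i) := by
      simp only [Finset.mem_insert, Finset.mem_erase, ne_eq, not_true_eq_false, false_and, or_false]
      rintro rfl
      exact hj hi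
    have := le_L4_of_card u hcard hi'
    rwa [Finset.sum_insert hj', Finset.sum_erase_eq_sub hi] at this
  have h3 := Finset.sum_le_sum h2
  simp only [Finset.sum_add_distrib, Finset.sum_sub_distrib, ← Finset.mul_sum, Finset.sum_const,
    hT, nsmul_eq_mul, mul_one] at h3
  have h4 : (1 / (k : ℝ)) * (k * u j + (k * ∑ i ∈ T, u i - ∑ i ∈ T, u i))
      = u j + ∑ i ∈ T, u i - (1 / (k : ℝ)) * ∑ i ∈ T, u i := by
    field_simp
    ring
  linarith

lemma L4_smul_indic_of_mem {n k : ℕ} (hk : 1 ≤ k) {T : Finset (Fin n)} (hT : T.card = k)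
    {y : Fin n} (hy : y ∈ T) : L4 n k ((k : ℝ) • indic T) y = 0 := by
  have hk0 : (0 : ℝ) < k := by exact_mod_cast hk
  have hk1 : (1 : ℝ) ≤ k := by exact_mod_cast hk
  have h : sigmaExcl n k ((k : ℝ) • indic T) y ≤ k * (k - 1) := by
    refine sigmaExcl_le (mul_nonneg hk0.le (by linarith)) fun S _ hyS => ?_
    have hcard : (S ∩ T).card ≤ k - 1 := by
      rw [← hT, ← Finset.card_erase_of_mem hy]
      refine Finset.card_le_card fun i hi => ?_
      rw [Finset.mem_inter] at hi
      exact Finset.mem_erase.2 ⟨fun h => hyS (h ▸ hi.1), hi.2⟩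
    have hcard' : ((S ∩ T).card : ℝ) ≤ k - 1 := by
      have : (S ∩ T).card + 1 ≤ k := by omega
      have : ((S ∩ T).card : ℝ) + 1 ≤ k := by exact_mod_cast this
      linarith
    simp only [Pi.smul_apply, smul_eq_mul, indic, ← Finset.mul_sum, Finset.sum_ite_mem,
      Finset.sum_const, nsmul_eq_mul, mul_one]
    gcongr
  have h' : (1 / (k : ℝ)) * sigmaExcl n k ((k : ℝ) • indic T) y ≤ k - 1 := by
    rw [one_div, inv_mul_eq_div, div_le_iff₀ hk0]
    linarith
  refine max_eq_left ?_
  simp only [Pi.smul_apply, smul_eq_mul, indic, if_pos hy, mul_one] at h' ⊢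
  linarith

lemma L4_smul_indic_le_of_notMem {n k : ℕ} (hk : 1 ≤ k) {T : Finset (Fin n)}
    {y : Fin n} (hy : y ∉ T) : L4 n k ((k : ℝ) • indic T) y ≤ k + 1 := by
  have hk0 : (0 : ℝ) < k := by exact_mod_cast hk
  have h : sigmaExcl n k ((k : ℝ) • indic T) y ≤ k * k := by
    refine sigmaExcl_le (by positivity) fun S hS _ => ?_
    have hcard : ((S ∩ T).card : ℝ) ≤ k := by
      rw [← hS]
      exact_mod_cast Finset.card_le_card Finset.inter_subset_left
    simp only [Pi.smul_apply, smul_eq_mul, indic, ← Finset.mul_sum, Finset.sum_ite_mem,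
      Finset.sum_const, nsmul_eq_mul, mul_one]
    gcongr
  have h' : (1 / (k : ℝ)) * sigmaExcl n k ((k : ℝ) • indic T) y ≤ k := by
    rw [one_div, inv_mul_eq_div, div_le_iff₀ hk0]
    exact h
  refine max_le (by positivity) ?_
  simp only [Pi.smul_apply, smul_eq_mul, indic, if_neg hy, mul_zero, sub_zero] at h' ⊢
  linarith

theorem stmt19 (n k : ℕ) (hk : 1 ≤ k) (hkn : k < n) :
    ∃ ψ : (Fin n → ℝ) → Finset (Fin n), (∀ u : Fin n → ℝ, (ψ u).card = k) ∧
      ∀ p : Fin n → ℝ, p ∈ simplex n → 1 - sigmaTop n k p < nthLarge p k →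
        ∃ ε > (0 : ℝ), ∀ u : Fin n → ℝ,
          (∑ i ∈ ψ u, p i) ≠ sigmaTop n k p →
          ε + sInf (Set.range fun u' => ∑ y, p y * L4 n k u' y) ≤ ∑ y, p y * L4 n k u y := by
  refine ⟨topSet k, card_topSet hkn.le, ?_⟩
  rintro p ⟨hp0, hp1⟩ hp
  set T := topSet k p with hTdef
  have hT : T.card = k := card_topSet hkn.le p
  have hsum : ∀ f : Fin n → ℝ, ∑ y, f y = ∑ y ∈ T, f y + ∑ y ∈ Tᶜ, f y := fun f =>
    (Finset.sum_add_sum_compl T f).symm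
  set q := ∑ y ∈ Tᶜ, p y with hq
  have hq' : 1 - sigmaTop n k p = q := by
    rw [← sum_topSet hk hkn p, ← hp1, hsum p]
    ring
  rw [hq'] at hp
  refine ⟨nthLarge p k - q, sub_pos.2 hp, fun u hu => ?_⟩
  have hinf : sInf (Set.range fun u' => ∑ y, p y * L4 n k u' y) ≤ q * (k + 1) := by
    refine (csInf_le ⟨0, ?_⟩ (Set.mem_range_self ((k : ℝ) • indic T))).trans ?_
    · rintro _ ⟨u', rfl⟩
      exact Finset.sum_nonneg fun y _ => mul_nonneg (hp0 y) (L4_nonneg n k u' y)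
    · rw [hsum, Finset.sum_eq_zero fun y hy => by rw [L4_smul_indic_of_mem hk hT hy, mul_zero],
        zero_add, hq, Finset.sum_mul]
      refine Finset.sum_le_sum fun y hy => mul_le_mul_of_nonneg_left ?_ (hp0 y)
      exact L4_smul_indic_le_of_notMem hk (Finset.mem_compl.1 hy)
  have hout : q * (k + 1) ≤ q * ∑ i ∈ T, L4 n k u i + ∑ y ∈ Tᶜ, p y * L4 n k u y := by
    rw [hq, Finset.sum_mul, Finset.sum_mul, ← Finset.sum_add_distrib]
    refine Finset.sum_le_sum fun y hy => ?_
    rw [← mul_add]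
    exact mul_le_mul_of_nonneg_left
      (add_one_le_sum_L4_add_L4 hk u hT (Finset.mem_compl.1 hy)) (hp0 y)
  have hin : nthLarge p k * ∑ i ∈ T, L4 n k u i ≤ ∑ y ∈ T, p y * L4 n k u y := by
    rw [Finset.mul_sum]
    exact Finset.sum_le_sum fun y hy => mul_le_mul_of_nonneg_right
      (nthLarge_le_of_mem_topSet hk hkn hy) (L4_nonneg n k u y)
  have hone : 1 ≤ ∑ i ∈ T, L4 n k u i := by
    obtain ⟨i, hiT, hi⟩ : ∃ i ∈ T, i ∉ topSet k u := by
      by_contra! hc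
      have : T = topSet k u :=
        Finset.eq_of_subset_of_card_le hc (by rw [hT, card_topSet hkn.le])
      exact hu (by rw [← this, hTdef, sum_topSet hk hkn p])
    exact (one_le_L4_of_notMem_topSet hk hkn hi).trans
      (Finset.single_le_sum (fun y _ => L4_nonneg n k u y) hiT)
  have hmul := mul_le_mul_of_nonneg_left hone (sub_nonneg.2 hp.le)
  rw [hsum fun y => p y * L4 n k u y]
  linarith
end
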